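/- For every complex number d with Re(d) > 0, there holds ₃F₂(3, 3, d+1; 9/2, d; 1/2) = (105π/4)(9/d − 5/2) − 105(7/d − 2). -/

import Mathlib

open scoped Nat

/-- Pochhammer symbol `(x)_k = x (x+1) ⋯ (x+k-1)` for a complex number `x`. -/
noncomputable def poch (x : ℂ) (k : ℕ) : ℂ := (ascPochhammer ℂ k).eval x

/-- The generalized hypergeometric series
`ₚF_q(a₁,…,aₚ; b₁,…,b_q; z) = ∑ₖ ((a₁)ₖ ⋯ (aₚ)ₖ)/((b₁)ₖ ⋯ (b_q)ₖ) · zᵏ/k!`. -/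
noncomputable def hyp (a b : List ℂ) (z : ℂ) : ℂ :=
  ∑' k : ℕ, ((a.map (poch · k)).prod / (b.map (poch · k)).prod) * z ^ k / (k ! : ℂ)

open Finset intervalIntegral

/-- The general term `n! / (3 · 5 ⋯ (2 n + 1))` of Euler's series for `π / 2`. -/
noncomputable def eulerTerm (n : ℕ) : ℝ := ∏ i ∈ range n, ((i : ℝ) + 1) / (2 * i + 3)

lemma eulerTerm_succ (n : ℕ) :
    eulerTerm (n + 1) = eulerTerm n * (((n : ℝ) + 1) / (2 * n + 3)) :=
  prod_range_succ _ _

lemma eulerTerm_pos (n : ℕ) : 0 < eulerTerm n :=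
  prod_pos fun _ _ => by positivity

lemma eulerTerm_le (n : ℕ) : eulerTerm n ≤ (1 / 2) ^ n := by
  induction n with
  | zero => simp [eulerTerm]
  | succ n ih =>
    rw [eulerTerm_succ, pow_succ]
    refine mul_le_mul ih ?_ (by positivity) (by positivity)
    rw [div_le_div_iff₀ (by positivity) (by positivity)]
    linarith

lemma integral_sin_pow_odd_eq_eulerTerm (n : ℕ) :
    ∫ x in 0..Real.pi, Real.sin x ^ (2 * n + 1) = 2 * 2 ^ n * eulerTerm n := by
  have h (i : ℕ) : (2 * (i : ℝ) + 2) / (2 * i + 3) = 2 * ((i + 1) / (2 * i + 3)) := by ring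
  simp_rw [integral_sin_pow_odd, h, prod_mul_distrib, prod_const, card_range, eulerTerm, mul_assoc]

lemma integral_sin_div_one_add_cos_sq :
    ∫ x in 0..Real.pi, Real.sin x / (1 + Real.cos x ^ 2) = Real.pi / 2 := by
  have h (x : ℝ) : HasDerivAt (fun y => -Real.arctan (Real.cos y))
      (Real.sin x / (1 + Real.cos x ^ 2)) x := by
    refine (Real.hasDerivAt_cos x).arctan.neg.congr_deriv ?_
    ring
  rw [integral_eq_sub_of_hasDerivAt (fun x _ => h x)]
  · simp [Real.arctan_neg]
    ring
  · refine Continuous.intervalIntegrable (Real.continuous_sin.div (by fun_prop) fun x => ?_) _ _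
    positivity

/-- Euler's series for `π / 2`. -/
lemma hasSum_eulerTerm : HasSum eulerTerm (Real.pi / 2) := by
  have hsq (x : ℝ) : Real.sin x ^ 2 / 2 ≤ 1 / 2 := by linarith [Real.sin_sq_le_one x]
  have key : HasSum (fun n : ℕ => ∫ x in 0..Real.pi, Real.sin x / 2 * (Real.sin x ^ 2 / 2) ^ n)
      (∫ x in 0..Real.pi, Real.sin x / (1 + Real.cos x ^ 2)) := by
    have hgeom : Summable fun n : ℕ => (1 / 2 : ℝ) ^ n :=
      summable_geometric_of_lt_one (by norm_num) (by norm_num)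
    refine hasSum_integral_of_dominated_convergence (fun n _ => (1 / 2) ^ n)
      (fun n => Continuous.aestronglyMeasurable (by fun_prop))
      (fun n => .of_forall fun x _ => ?_) (.of_forall fun x _ => hgeom)
      intervalIntegrable_const (.of_forall fun x _ => ?_)
    · rw [norm_mul, norm_pow]
      have h1 : ‖Real.sin x / 2‖ ≤ 1 := by
        rw [norm_div, Real.norm_eq_abs, Real.norm_two]
        linarith [Real.abs_sin_le_one x]
      have h2 : ‖Real.sin x ^ 2 / 2‖ ≤ 1 / 2 := by
        rw [Real.norm_of_nonneg (by positivity)]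
        exact hsq x
      calc _ ≤ 1 * (1 / 2 : ℝ) ^ n := by gcongr
        _ = _ := one_mul _
    · have h := (hasSum_geometric_of_lt_one (r := Real.sin x ^ 2 / 2) (by positivity)
        (by linarith [hsq x])).mul_left (Real.sin x / 2)
      have h1 : 1 - Real.sin x ^ 2 / 2 = (1 + Real.cos x ^ 2) / 2 := by
        rw [Real.sin_sq]; ring
      rwa [h1, inv_div, div_mul_div_cancel₀ two_ne_zero] at h
  rw [integral_sin_div_one_add_cos_sq] at key
  convert key using 2 with n
  have h (x : ℝ) : Real.sin x / 2 * (Real.sin x ^ 2 / 2) ^ n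
      = (2 * 2 ^ n)⁻¹ * Real.sin x ^ (2 * n + 1) := by
    rw [div_pow, pow_succ _ (2 * n), pow_mul]
    field_simp
  simp_rw [h, integral_const_mul, integral_sin_pow_odd_eq_eulerTerm]
  field_simp

lemma summable_pow_mul_eulerTerm_div (j : ℕ) :
    Summable fun n : ℕ => (n : ℝ) ^ j * (eulerTerm n / ((2 * n + 3) * (2 * n + 5))) := by
  refine Summable.of_nonneg_of_le (fun n => ?_) (fun n => ?_)
    (summable_pow_mul_geometric_of_norm_lt_one j (r := (1 / 2 : ℝ)) (by norm_num))
  · have := (eulerTerm_pos n).le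
    positivity
  · gcongr
    refine (div_le_self (eulerTerm_pos n).le ?_).trans (eulerTerm_le n)
    nlinarith [(n.cast_nonneg : (0 : ℝ) ≤ n)]

lemma hasSum_succ_sub {G : ℕ → ℝ} (hG : Summable G) :
    HasSum (fun n => G (n + 1) - G n) (-G 0) := by
  have h := ((hasSum_nat_add_iff' 1).2 hG.hasSum).sub hG.hasSum
  simpa using h

/-- The `n`-th term of the series `₂F₁(3, 3; 9/2; 1/2)`. -/
noncomputable def gaussTerm (n : ℕ) : ℝ :=
  105 / 4 * ((n + 1) ^ 2 * (n + 2) ^ 2 / ((2 * n + 3) * (2 * n + 5) * (2 * n + 7))) * eulerTerm n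

lemma hasSum_gaussTerm : HasSum gaussTerm (210 - 525 / 8 * Real.pi) := by
  let G (n : ℕ) : ℝ := (-3150 - 15435 / 4 * n - 4515 / 4 * n ^ 2 - 105 / 4 * n ^ 3) *
    (eulerTerm n / ((2 * n + 3) * (2 * n + 5)))
  have hG : Summable G := by
    have s := summable_pow_mul_eulerTerm_div
    refine (((((s 0).mul_left (-3150)).sub ((s 1).mul_left (15435 / 4))).sub
      ((s 2).mul_left (4515 / 4))).sub ((s 3).mul_left (105 / 4))).congr fun n => ?_
    simp only [G]
    ring
  have hterm : gaussTerm = fun n => -525 / 4 * eulerTerm n + (G (n + 1) - G n) := by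
    ext n
    simp only [G, gaussTerm, eulerTerm_succ]
    push_cast
    field_simp
    ring
  have hval : 210 - 525 / 8 * Real.pi = -525 / 4 * (Real.pi / 2) + -G 0 := by
    simp only [G, eulerTerm, prod_range_zero]
    push_cast
    ring
  rw [hterm, hval]
  exact (hasSum_eulerTerm.mul_left _).add (hasSum_succ_sub hG)

lemma hasSum_mul_gaussTerm :
    HasSum (fun n : ℕ => n * gaussTerm n) (945 / 4 * Real.pi - 735) := by
  let G (n : ℕ) : ℝ :=
    (11025 + 26355 / 2 * n + 13965 / 4 * n ^ 2 - 105 * n ^ 3 - 105 / 4 * n ^ 4) *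
      (eulerTerm n / ((2 * n + 3) * (2 * n + 5)))
  have hG : Summable G := by
    have s := summable_pow_mul_eulerTerm_div
    refine ((((((s 0).mul_left 11025).add ((s 1).mul_left (26355 / 2))).add
      ((s 2).mul_left (13965 / 4))).sub ((s 3).mul_left 105)).sub
      ((s 4).mul_left (105 / 4))).congr fun n => ?_
    simp only [G]
    ring
  have hterm : (fun n : ℕ => n * gaussTerm n) =
      fun n => 945 / 2 * eulerTerm n + (G (n + 1) - G n) := by
    ext n
    simp only [G, gaussTerm, eulerTerm_succ]
    push_cast
    field_simp
    ring
  have hval : 945 / 4 * Real.pi - 735 = 945 / 2 * (Real.pi / 2) + -G 0 := by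
    simp only [G, eulerTerm, prod_range_zero]
    push_cast
    ring
  rw [hterm, hval]
  exact (hasSum_eulerTerm.mul_left _).add (hasSum_succ_sub hG)

lemma poch_zero (x : ℂ) : poch x 0 = 1 := by simp [poch]

lemma poch_succ (x : ℂ) (n : ℕ) : poch x (n + 1) = poch x n * (x + n) :=
  ascPochhammer_succ_eval n x

lemma poch_ne_zero {x : ℂ} (hx : 0 < x.re) (n : ℕ) : poch x n ≠ 0 := by
  induction n with
  | zero => simp [poch_zero]
  | succ n ih =>
    rw [poch_succ]
    refine mul_ne_zero ih fun h => ?_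
    have h' := congrArg Complex.re h
    simp only [Complex.add_re, Complex.natCast_re, Complex.zero_re] at h'
    linarith [(n.cast_nonneg : (0 : ℝ) ≤ n)]

lemma poch_add_one_mul (x : ℂ) (n : ℕ) : poch (x + 1) n * x = poch x n * (x + n) := by
  induction n with
  | zero => simp [poch_zero]
  | succ n ih =>
    rw [poch_succ, poch_succ, mul_right_comm, ih]
    push_cast
    ring

lemma poch_three (n : ℕ) : poch 3 n = n ! * (n + 1) * (n + 2) / 2 := by
  induction n with
  | zero => simp [poch_zero]
  | succ n ih =>
    rw [poch_succ, ih, Nat.factorial_succ]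
    push_cast
    ring

lemma poch_nine_halves_mul_eulerTerm (n : ℕ) :
    poch (9 / 2) n * (105 * 2 ^ n * eulerTerm n) =
      n ! * ((2 * n + 3) * (2 * n + 5) * (2 * n + 7)) := by
  induction n with
  | zero => norm_num [poch_zero, eulerTerm]
  | succ n ih =>
    have h : (2 * (n : ℂ) + 3) ≠ 0 := by exact_mod_cast (by omega : 2 * n + 3 ≠ 0)
    rw [poch_succ, eulerTerm_succ, Nat.factorial_succ]
    push_cast
    calc _ = poch (9 / 2) n * (105 * 2 ^ n * eulerTerm n) *
          ((2 * n + 9) * ((n + 1) / (2 * n + 3))) := by ring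
      _ = _ := by
        rw [ih]
        field_simp
        ring

lemma hyp_term_eq {d : ℂ} (hd : 0 < d.re) (n : ℕ) :
    ((([3, 3, d + 1] : List ℂ).map (poch · n)).prod /
      (([9 / 2, d] : List ℂ).map (poch · n)).prod) * (1 / 2) ^ n / (n ! : ℂ) =
      (gaussTerm n : ℂ) + d⁻¹ * ((n * gaussTerm n : ℝ) : ℂ) := by
  have hd0 : d ≠ 0 := by
    rintro rfl
    simp at hd
  have h3 : (2 * (n : ℂ) + 3) ≠ 0 := by exact_mod_cast (by omega : 2 * n + 3 ≠ 0)
  have h5 : (2 * (n : ℂ) + 5) ≠ 0 := by exact_mod_cast (by omega : 2 * n + 5 ≠ 0)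
  have h7 : (2 * (n : ℂ) + 7) ≠ 0 := by exact_mod_cast (by omega : 2 * n + 7 ≠ 0)
  have hf : (n ! : ℂ) ≠ 0 := by exact_mod_cast n.factorial_ne_zero
  have ht : (eulerTerm n : ℂ) ≠ 0 := by exact_mod_cast (eulerTerm_pos n).ne'
  have hp := poch_ne_zero hd n
  have e1 : poch (d + 1) n = poch d n * (d + n) / d := by
    rw [eq_div_iff hd0, poch_add_one_mul]
  have e2 : poch (9 / 2) n =
      n ! * ((2 * n + 3) * (2 * n + 5) * (2 * n + 7)) / (105 * 2 ^ n * eulerTerm n) := by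
    rw [eq_div_iff (by simp [ht]), poch_nine_halves_mul_eulerTerm]
  simp only [List.map_cons, List.map_nil, List.prod_cons, List.prod_nil, mul_one, e1, e2,
    poch_three, gaussTerm]
  push_cast
  rw [one_div, inv_pow]
  field_simp
  ring

theorem gauss_second_m1_n1 (d : ℂ) (hd : 0 < d.re) :
    hyp [3, 3, d + 1] [9/2, d] (1/2) =
      105 * (Real.pi : ℂ) / 4 * (9 / d - 5/2) - 105 * (7 / d - 2) := by
  have h := (Complex.hasSum_ofReal.2 hasSum_gaussTerm).add
    ((Complex.hasSum_ofReal.2 hasSum_mul_gaussTerm).mul_left d⁻¹)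
  unfold hyp
  simp_rw [hyp_term_eq hd]
  rw [h.tsum_eq]
  push_cast
  ring
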